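/- arXiv:1408.2142 — 2 statements merged into one kernel-verified Lean document; each statement's English description precedes it below -/
import Mathlib

section
/- With the notation of the fibrewise higher-order pre-symplectic structure (spaces A, C_l, D_l, V = A ⊕ C ⊕ D, currents J^{(r)}, form Ω), let C_S ⊆ C and D_S ⊆ D be the subspaces of arrays that are totally symmetric in all their upper indices (c^{μ₁…μ_l λ} = c^{(μ₁…μ_l λ)} and d^{μ₁…μ_l λ}{}_ν = d^{(μ₁…μ_l λ)}{}_ν), and set V_S := A ⊕ C_S ⊕ D_S. Then the map ξ ↦ (J^{(r)}(ξ))_{r=0}^{k} restricted to V_S is still surjective onto ⊕_{r=0}^{k} Sym^r, and consequently the inclusion V_S ↪ V induces a linear isomorphism V_S/rad(Ω|_{V_S}) ≅ V/rad(Ω) intertwining the nondegenerate forms induced by Ω. -/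
set_option synthInstance.maxHeartbeats 1000000
set_option maxSynthPendingDepth 3
set_option maxHeartbeats 1000000

noncomputable section

open scoped BigOperators

/-- Rank-`m` arrays `t^{μ₁…μ_m}`. -/
abbrev Arr (n m : ℕ) : Type := (Fin m → Fin n) → ℝ
/-- Arrays `c^{μ₁…μ_m λ}` with `m` group indices and one extra index `λ`. -/
abbrev ArrC (n m : ℕ) : Type := (Fin m → Fin n) → Fin n → ℝ
/-- Arrays `d^{μ₁…μ_m λ}{}_ν`. -/
abbrev ArrD (n m : ℕ) : Type := (Fin m → Fin n) → Fin n → Fin n → ℝ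

/-- The subspace `Sym^m` of totally symmetric rank-`m` arrays. -/
def SymA (n m : ℕ) : Submodule ℝ (Arr n m) where
  carrier := {t | ∀ (σ : Equiv.Perm (Fin m)) (s : Fin m → Fin n), t (s ∘ σ) = t s}
  add_mem' := by intro a b ha hb σ s; simp [ha σ s, hb σ s]
  zero_mem' := by intro σ s; rfl
  smul_mem' := by intro c a ha σ s; simp [ha σ s]

/-- The space `C_m` of arrays `c^{μ₁…μ_m λ}` symmetric in `μ₁…μ_m`. -/
def SymC (n m : ℕ) : Submodule ℝ (ArrC n m) where
  carrier := {c | ∀ (σ : Equiv.Perm (Fin m)) (t : Fin m → Fin n) (lam : Fin n),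
    c (t ∘ σ) lam = c t lam}
  add_mem' := by intro a b ha hb σ t lam; simp [ha σ t lam, hb σ t lam]
  zero_mem' := by intro σ t lam; rfl
  smul_mem' := by intro k a ha σ t lam; simp [ha σ t lam]

/-- The space `D_m` of arrays `d^{μ₁…μ_m λ}{}_ν` symmetric in `μ₁…μ_m`. -/
def SymD (n m : ℕ) : Submodule ℝ (ArrD n m) where
  carrier := {d | ∀ (σ : Equiv.Perm (Fin m)) (t : Fin m → Fin n) (lam nu : Fin n),
    d (t ∘ σ) lam nu = d t lam nu}
  add_mem' := by intro a b ha hb σ t lam nu; simp [ha σ t lam nu, hb σ t lam nu]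
  zero_mem' := by intro σ t lam nu; rfl
  smul_mem' := by intro k a ha σ t lam nu; simp [ha σ t lam nu]

/-- `A = ⊕_{r=0}^{k} Sym^r`. -/
abbrev SpA (n k : ℕ) : Type := ∀ r : Fin (k + 1), ↥(SymA n (r : ℕ))
/-- `C = ⊕_{l=0}^{k−1} C_l`. -/
abbrev SpC (n k : ℕ) : Type := ∀ l : Fin k, ↥(SymC n (l : ℕ))
/-- `D = ⊕_{l=0}^{k−1} D_l`. -/
abbrev SpD (n k : ℕ) : Type := ∀ l : Fin k, ↥(SymD n (l : ℕ))

/-- `V = A ⊕ C ⊕ D` for a `(K+1)`-th order theory. -/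
abbrev V1 (n K : ℕ) : Type := SpA n (K + 1) × SpC n (K + 1) × SpD n (K + 1)

/-- The array `c^{μ₁…μ_l λ}` viewed as a rank-`(l+1)` array. -/
def comb (n l : ℕ) (q : ArrC n l) : Arr n (l + 1) :=
  fun s => q (fun i => s (Fin.castSucc i)) (s (Fin.last l))

/-- Total symmetrization of a rank-`m` array. -/
def symArr (n m : ℕ) (q : Arr n m) : Arr n m :=
  fun s => (m.factorial : ℝ)⁻¹ * ∑ σ : Equiv.Perm (Fin m), q (s ∘ σ)

lemma symArr_mem (n m : ℕ) (q : Arr n m) : symArr n m q ∈ SymA n m := by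
  intro σ₀ s
  unfold symArr
  congr 1
  calc ∑ σ : Equiv.Perm (Fin m), q ((s ∘ σ₀) ∘ σ)
      = ∑ σ : Equiv.Perm (Fin m), q (s ∘ ((Equiv.mulLeft σ₀) σ)) := by
        refine Finset.sum_congr rfl fun σ _ => ?_
        congr 1
    _ = ∑ σ : Equiv.Perm (Fin m), q (s ∘ σ) :=
        Equiv.sum_comp (Equiv.mulLeft σ₀) (fun τ : Equiv.Perm (Fin m) => q (s ∘ ⇑τ))

/-- The current `J^{(0)} = Σ_λ d^λ{}_λ`. -/
def Jlow (n K : ℕ) (ξ : V1 n K) : ℝ :=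
  ∑ lam : Fin n, (ξ.2.2 ⟨0, Nat.succ_pos K⟩ : ArrD n 0) Fin.elim0 lam lam

/-- The current `J^{μ₁…μ_r}` of rank `r = l+1 ≥ 1`:
`J = c^{(μ₁…μ_r)} + Σ_λ d^{μ₁…μ_r λ}{}_λ` for `1 ≤ r ≤ k−1`, and
`J = c^{(μ₁…μ_k)}` for `r = k`. -/
def Jhigh (n K : ℕ) (ξ : V1 n K) (l : Fin (K + 1)) : Arr n ((l : ℕ) + 1) :=
  fun s =>
    symArr n ((l : ℕ) + 1) (comb n (l : ℕ) (ξ.2.1 l : ArrC n (l : ℕ))) s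
      + (if h : (l : ℕ) + 1 < K + 1 then
          ∑ lam : Fin n, (ξ.2.2 ⟨(l : ℕ) + 1, h⟩ : ArrD n ((l : ℕ) + 1)) s lam lam
        else 0)

lemma Jhigh_mem (n K : ℕ) (ξ : V1 n K) (l : Fin (K + 1)) :
    Jhigh n K ξ l ∈ SymA n ((l : ℕ) + 1) := by
  intro σ s
  unfold Jhigh
  rw [symArr_mem n ((l : ℕ) + 1) (comb n (l : ℕ) (ξ.2.1 l : ArrC n (l : ℕ))) σ s]
  congr 1
  by_cases h : (l : ℕ) + 1 < K + 1
  · simp only [dif_pos h]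
    exact Finset.sum_congr rfl fun lam _ => (ξ.2.2 ⟨(l : ℕ) + 1, h⟩).2 σ s lam lam
  · simp only [dif_neg h]

/-- The family of currents `(J^{(r)}(ξ))_{r=0}^{k}`, as an element of `⊕ Sym^r`. -/
def Jfam (n K : ℕ) (ξ : V1 n K) : SpA n (K + 1) := fun r =>
  Fin.cases (motive := fun r : Fin (K + 2) => ↥(SymA n (r : ℕ)))
    ⟨fun _ => Jlow n K ξ, fun _ _ => rfl⟩
    (fun l => ⟨Jhigh n K ξ l, Jhigh_mem n K ξ l⟩) r

lemma Jlow_add (n K : ℕ) (ξ η : V1 n K) :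
    Jlow n K (ξ + η) = Jlow n K ξ + Jlow n K η := by
  unfold Jlow
  rw [← Finset.sum_add_distrib]
  rfl

lemma Jlow_smul (n K : ℕ) (c : ℝ) (ξ : V1 n K) :
    Jlow n K (c • ξ) = c * Jlow n K ξ := by
  unfold Jlow
  rw [Finset.mul_sum]
  rfl

lemma Jhigh_add (n K : ℕ) (ξ η : V1 n K) (l : Fin (K + 1)) :
    Jhigh n K (ξ + η) l = Jhigh n K ξ l + Jhigh n K η l := by
  funext s
  show Jhigh n K (ξ + η) l s = Jhigh n K ξ l s + Jhigh n K η l s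
  unfold Jhigh symArr
  have hc : ∑ σ : Equiv.Perm (Fin ((l : ℕ) + 1)),
        comb n (l : ℕ) (((ξ + η).2.1 l : ArrC n (l : ℕ))) (s ∘ σ)
      = (∑ σ : Equiv.Perm (Fin ((l : ℕ) + 1)),
          comb n (l : ℕ) ((ξ.2.1 l : ArrC n (l : ℕ))) (s ∘ σ))
        + ∑ σ : Equiv.Perm (Fin ((l : ℕ) + 1)),
            comb n (l : ℕ) ((η.2.1 l : ArrC n (l : ℕ))) (s ∘ σ) := by
    rw [← Finset.sum_add_distrib]
    rfl
  rw [hc, mul_add]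
  by_cases h : (l : ℕ) + 1 < K + 1
  · simp only [dif_pos h]
    have hd : ∑ lam : Fin n, ((ξ + η).2.2 ⟨(l : ℕ) + 1, h⟩ : ArrD n ((l : ℕ) + 1)) s lam lam
        = (∑ lam : Fin n, (ξ.2.2 ⟨(l : ℕ) + 1, h⟩ : ArrD n ((l : ℕ) + 1)) s lam lam)
          + ∑ lam : Fin n, (η.2.2 ⟨(l : ℕ) + 1, h⟩ : ArrD n ((l : ℕ) + 1)) s lam lam := by
      rw [← Finset.sum_add_distrib]
      rfl
    rw [hd]
    ring
  · simp only [dif_neg h]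
    ring

lemma Jhigh_smul (n K : ℕ) (c : ℝ) (ξ : V1 n K) (l : Fin (K + 1)) :
    Jhigh n K (c • ξ) l = c • Jhigh n K ξ l := by
  funext s
  show Jhigh n K (c • ξ) l s = c * Jhigh n K ξ l s
  unfold Jhigh symArr
  have hc : ∑ σ : Equiv.Perm (Fin ((l : ℕ) + 1)),
        comb n (l : ℕ) (((c • ξ).2.1 l : ArrC n (l : ℕ))) (s ∘ σ)
      = c * ∑ σ : Equiv.Perm (Fin ((l : ℕ) + 1)),
          comb n (l : ℕ) ((ξ.2.1 l : ArrC n (l : ℕ))) (s ∘ σ) := by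
    rw [Finset.mul_sum]
    rfl
  rw [hc]
  by_cases h : (l : ℕ) + 1 < K + 1
  · simp only [dif_pos h]
    have hd : ∑ lam : Fin n, ((c • ξ).2.2 ⟨(l : ℕ) + 1, h⟩ : ArrD n ((l : ℕ) + 1)) s lam lam
        = c * ∑ lam : Fin n, (ξ.2.2 ⟨(l : ℕ) + 1, h⟩ : ArrD n ((l : ℕ) + 1)) s lam lam := by
      rw [Finset.mul_sum]
      rfl
    rw [hd]
    ring
  · simp only [dif_neg h]
    ring

lemma Jfam_add (n K : ℕ) (ξ η : V1 n K) :
    Jfam n K (ξ + η) = Jfam n K ξ + Jfam n K η := by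
  funext r
  refine Fin.cases ?_ ?_ r
  · apply Subtype.ext
    show (fun _ => Jlow n K (ξ + η)) = _
    funext t
    show Jlow n K (ξ + η) = Jlow n K ξ + Jlow n K η
    exact Jlow_add n K ξ η
  · intro l
    apply Subtype.ext
    show Jhigh n K (ξ + η) l = _
    rw [Jhigh_add]
    rfl

lemma Jfam_smul (n K : ℕ) (c : ℝ) (ξ : V1 n K) :
    Jfam n K (c • ξ) = c • Jfam n K ξ := by
  funext r
  refine Fin.cases ?_ ?_ r
  · apply Subtype.ext
    funext t
    show Jlow n K (c • ξ) = c * Jlow n K ξ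
    exact Jlow_smul n K c ξ
  · intro l
    apply Subtype.ext
    show Jhigh n K (c • ξ) l = _
    rw [Jhigh_smul]
    rfl

/-- The linear map `ξ ↦ (a, (J^{(r)}(ξ))_r)` whose kernel is the radical of `Ω`. -/
def Theta (n K : ℕ) : V1 n K →ₗ[ℝ] (SpA n (K + 1) × SpA n (K + 1)) where
  toFun ξ := (ξ.1, Jfam n K ξ)
  map_add' ξ η := by
    refine Prod.ext rfl ?_
    exact Jfam_add n K ξ η
  map_smul' c ξ := by
    refine Prod.ext rfl ?_
    exact Jfam_smul n K c ξ
def Omega1 (n K : ℕ) (ξ ξ' : V1 n K) : ℝ :=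
  (Jlow n K ξ * (ξ'.1 ⟨0, Nat.succ_pos (K + 1)⟩ : Arr n 0) Fin.elim0
      - Jlow n K ξ' * (ξ.1 ⟨0, Nat.succ_pos (K + 1)⟩ : Arr n 0) Fin.elim0)
  + ∑ l : Fin (K + 1), ∑ s : Fin ((l : ℕ) + 1) → Fin n,
      (Jhigh n K ξ l s
          * (ξ'.1 ⟨(l : ℕ) + 1, Nat.succ_lt_succ l.isLt⟩ : Arr n ((l : ℕ) + 1)) s
        - Jhigh n K ξ' l s
          * (ξ.1 ⟨(l : ℕ) + 1, Nat.succ_lt_succ l.isLt⟩ : Arr n ((l : ℕ) + 1)) s)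

/-- The array `d^{μ₁…μ_l λ}{}_ν` with its upper indices combined into a single
rank-`(l+1)` slot. -/
def combD (n l : ℕ) (q : ArrD n l) : (Fin (l + 1) → Fin n) → Fin n → ℝ :=
  fun s nu => q (fun i => s (Fin.castSucc i)) (s (Fin.last l)) nu

/-- The subspace `V_S = A ⊕ C_S ⊕ D_S ⊆ V` of configurations with momenta
totally symmetric in all their upper indices. -/
def VS (n K : ℕ) : Submodule ℝ (V1 n K) where
  carrier := {ξ |
    (∀ (l : Fin (K + 1)) (σ : Equiv.Perm (Fin ((l : ℕ) + 1)))
        (s : Fin ((l : ℕ) + 1) → Fin n),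
      comb n (l : ℕ) (ξ.2.1 l : ArrC n (l : ℕ)) (s ∘ σ)
        = comb n (l : ℕ) (ξ.2.1 l : ArrC n (l : ℕ)) s)
    ∧ (∀ (l : Fin (K + 1)) (σ : Equiv.Perm (Fin ((l : ℕ) + 1)))
        (s : Fin ((l : ℕ) + 1) → Fin n) (nu : Fin n),
      combD n (l : ℕ) (ξ.2.2 l : ArrD n (l : ℕ)) (s ∘ σ) nu
        = combD n (l : ℕ) (ξ.2.2 l : ArrD n (l : ℕ)) s nu)}
  add_mem' := by
    rintro x y ⟨hxc, hxd⟩ ⟨hyc, hyd⟩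
    constructor
    · intro l σ s
      show comb n (l : ℕ) (x.2.1 l : ArrC n (l : ℕ)) (s ∘ σ)
            + comb n (l : ℕ) (y.2.1 l : ArrC n (l : ℕ)) (s ∘ σ)
          = comb n (l : ℕ) (x.2.1 l : ArrC n (l : ℕ)) s
            + comb n (l : ℕ) (y.2.1 l : ArrC n (l : ℕ)) s
      rw [hxc l σ s, hyc l σ s]
    · intro l σ s nu
      show combD n (l : ℕ) (x.2.2 l : ArrD n (l : ℕ)) (s ∘ σ) nu
            + combD n (l : ℕ) (y.2.2 l : ArrD n (l : ℕ)) (s ∘ σ) nu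
          = combD n (l : ℕ) (x.2.2 l : ArrD n (l : ℕ)) s nu
            + combD n (l : ℕ) (y.2.2 l : ArrD n (l : ℕ)) s nu
      rw [hxd l σ s nu, hyd l σ s nu]
  zero_mem' := by
    constructor
    · intro l σ s; rfl
    · intro l σ s nu; rfl
  smul_mem' := by
    rintro c x ⟨hxc, hxd⟩
    constructor
    · intro l σ s
      show c * comb n (l : ℕ) (x.2.1 l : ArrC n (l : ℕ)) (s ∘ σ)
          = c * comb n (l : ℕ) (x.2.1 l : ArrC n (l : ℕ)) s
      rw [hxc l σ s]
    · intro l σ s nu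
      show c * combD n (l : ℕ) (x.2.2 l : ArrD n (l : ℕ)) (s ∘ σ) nu
          = c * combD n (l : ℕ) (x.2.2 l : ArrD n (l : ℕ)) s nu
      rw [hxd l σ s nu]

/-- The permutation of `Fin (m + 1)` extending `σ` by fixing the last index. -/
def permFixLast {m : ℕ} (σ : Equiv.Perm (Fin m)) : Equiv.Perm (Fin (m + 1)) :=
  finSuccEquivLast.symm.permCongr (Equiv.optionCongr σ)

lemma snoc_comp_permFixLast {n m : ℕ} (t : Fin m → Fin n) (lam : Fin n)
    (σ : Equiv.Perm (Fin m)) :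
    (Fin.snoc t lam : Fin (m + 1) → Fin n) ∘ permFixLast σ
      = (Fin.snoc (t ∘ σ) lam : Fin (m + 1) → Fin n) := by
  funext i
  refine Fin.lastCases ?_ (fun j => ?_) i
  · simp [permFixLast]
  · simp [permFixLast]

/-- A totally symmetric array of rank `m + 1`, viewed as an element of `C_m`. -/
def splitLast (n m : ℕ) (t : SymA n (m + 1)) : SymC n m :=
  ⟨fun s lam => (t : Arr n (m + 1)) (Fin.snoc s lam : Fin (m + 1) → Fin n),
    fun σ s lam => by
      beta_reduce
      rw [← snoc_comp_permFixLast, t.2 (permFixLast σ)]⟩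

lemma comb_splitLast (n m : ℕ) (t : SymA n (m + 1)) :
    comb n m (splitLast n m t : ArrC n m) = t := by
  funext s
  exact congrArg (t : Arr n (m + 1)) (Fin.snoc_init_self s)

lemma symArr_of_mem {n m : ℕ} {t : Arr n m} (ht : t ∈ SymA n m) : symArr n m t = t := by
  funext s
  have hσ : ∀ σ : Equiv.Perm (Fin m), t (s ∘ σ) = t s := fun σ => ht σ s
  simp only [symArr, hσ, Finset.sum_const, Finset.card_univ, Fintype.card_perm,
    Fintype.card_fin, nsmul_eq_mul]
  exact inv_mul_cancel_left₀ (Nat.cast_ne_zero.2 m.factorial_ne_zero) _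

/-- The family in `D` whose only nonzero member is the multiple of the identity
`d^λ{}_ν = x δ^λ_ν` in rank `l = 0`. -/
def scalarD (n k : ℕ) (x : ℝ) : SpD n k := fun l =>
  ⟨fun _ lam nu => if (l : ℕ) = 0 ∧ lam = nu then x else 0, fun _ _ _ _ => rfl⟩

/-- The element of `V_S` with field components `a` and currents `J`. -/
def symLift (n K : ℕ) (a J : SpA n (K + 1)) : V1 n K :=
  (a, fun l => splitLast n l (J l.succ),
    scalarD n (K + 1) ((J 0).1 Fin.elim0 / n))

lemma symLift_mem_VS (n K : ℕ) (a J : SpA n (K + 1)) : symLift n K a J ∈ VS n K := by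
  constructor
  · intro l σ s
    rw [show (symLift n K a J).2.1 l = splitLast n l (J l.succ) from rfl, comb_splitLast]
    exact (J l.succ).2 σ s
  · rintro ⟨l, hl⟩ σ s nu
    rcases Nat.eq_zero_or_pos l with rfl | hpos
    · have hσ : σ = 1 := Subsingleton.elim (α := Equiv.Perm (Fin 1)) σ 1
      rw [hσ]
      rfl
    · simp [combD, symLift, scalarD, hpos.ne']

lemma Jfam_symLift {n : ℕ} (K : ℕ) (hn : 1 ≤ n) (a J : SpA n (K + 1)) :
    Jfam n K (symLift n K a J) = J := by
  funext r
  refine Fin.cases ?_ (fun l => ?_) r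
  · apply Subtype.ext
    funext s
    have hn' : (n : ℝ) ≠ 0 := Nat.cast_ne_zero.2 (by omega)
    have hs : s = Fin.elim0 := Subsingleton.elim (α := Fin 0 → Fin n) _ _
    subst hs
    change Jlow n K (symLift n K a J) = _
    simp [Jlow, symLift, scalarD, mul_div_cancel₀ _ hn']
  · apply Subtype.ext
    funext (s : Fin ((l : ℕ) + 1) → Fin n)
    change Jhigh n K (symLift n K a J) l s = _
    unfold Jhigh
    rw [show (symLift n K a J).2.1 l = splitLast n l (J l.succ) from rfl, comb_splitLast,
      symArr_of_mem (m := l + 1) (J l.succ).2]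
    simp [symLift, scalarD]

lemma Theta_symLift {n : ℕ} (K : ℕ) (hn : 1 ≤ n) (a J : SpA n (K + 1)) :
    Theta n K (symLift n K a J) = (a, J) :=
  Prod.ext rfl (Jfam_symLift K hn a J)

/-- The pairing `Σ_r ⟨u^{(r)}, v^{(r)}⟩` on `⊕_r Sym^r`. -/
def symPairing {n k : ℕ} (u v : SpA n k) : ℝ :=
  ∑ r : Fin (k + 1), ∑ s, (u r).1 s * (v r).1 s

lemma symPairing_zero_left {n k : ℕ} (v : SpA n k) : symPairing 0 v = 0 := by
  simp [symPairing]

lemma symPairing_zero_right {n k : ℕ} (u : SpA n k) : symPairing u 0 = 0 := by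
  simp [symPairing]

lemma eq_zero_of_symPairing_self {n k : ℕ} {u : SpA n k} (h : symPairing u u = 0) :
    u = 0 := by
  have hr := (Finset.sum_eq_zero_iff_of_nonneg fun r _ =>
    Finset.sum_nonneg fun s _ => mul_self_nonneg ((u r).1 s)).1 h
  funext r
  apply Subtype.ext
  funext s
  exact mul_self_eq_zero.1 ((Finset.sum_eq_zero_iff_of_nonneg fun s _ =>
    mul_self_nonneg ((u r).1 s)).1 (hr r (Finset.mem_univ r)) s
      (Finset.mem_univ s))

/-- The canonical symplectic form on pairs `(a, J)` of fields and currents. -/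
def canonicalForm {n k : ℕ} (x y : SpA n k × SpA n k) : ℝ :=
  symPairing x.2 y.1 - symPairing y.2 x.1

lemma canonicalForm_zero_left {n k : ℕ} (y : SpA n k × SpA n k) :
    canonicalForm 0 y = 0 := by
  simp [canonicalForm, symPairing_zero_left, symPairing_zero_right]

lemma canonicalForm_nondegenerate {n k : ℕ} {x : SpA n k × SpA n k}
    (h : ∀ y, canonicalForm x y = 0) : x = 0 := by
  refine Prod.ext (eq_zero_of_symPairing_self ?_) (eq_zero_of_symPairing_self ?_)
  · simpa [canonicalForm, symPairing_zero_right] using h (0, x.1)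
  · simpa [canonicalForm, symPairing_zero_left] using h (x.2, 0)

lemma Omega1_eq_canonicalForm (n K : ℕ) (ξ ξ' : V1 n K) :
    Omega1 n K ξ ξ' = canonicalForm (Theta n K ξ) (Theta n K ξ') := by
  have key : ∀ η η' : V1 n K, symPairing (Theta n K η).2 (Theta n K η').1
      = Jlow n K η * (η'.1 0).1 Fin.elim0
        + ∑ l : Fin (K + 1), ∑ s : Fin ((l : ℕ) + 1) → Fin n,
          Jhigh n K η l s * (η'.1 l.succ).1 s := by
    intro η η'
    unfold symPairing
    rw [Fin.sum_univ_succ]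
    congr 1
    exact Fintype.sum_eq_single (Fin.elim0 : Fin 0 → Fin n) fun s hs =>
      (hs (Subsingleton.elim (α := Fin 0 → Fin n) _ _)).elim
  unfold canonicalForm
  rw [key, key, add_sub_add_comm, ← Finset.sum_sub_distrib]
  simp only [← Finset.sum_sub_distrib]
  rfl

/-- the symmetric momenta suffice.
The current map `ξ ↦ (J^{(r)}(ξ))_r` restricted to `V_S` is still surjective
onto `⊕_{r=0}^{k} Sym^r`; the radical of `Ω|_{V_S}` is the restriction of the
kernel of `Θ`; and the inclusion `V_S ↪ V` induces a linear isomorphism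
`V_S/rad(Ω|_{V_S}) ≅ V/rad(Ω)` intertwining the (nondegenerate) forms induced
by `Ω`. -/
theorem statement_2 (n K : ℕ) (hn : 1 ≤ n) :
    -- surjectivity of the currents restricted to V_S
    (∀ targ : SpA n (K + 1), ∃ ξ : V1 n K, ξ ∈ VS n K ∧ Jfam n K ξ = targ)
    -- the radical of Ω|_{V_S} is the restriction of ker Θ
    ∧ (∀ ξ : ↥(VS n K),
        (∀ ξ' : ↥(VS n K), Omega1 n K (ξ : V1 n K) (ξ' : V1 n K) = 0)
          ↔ Theta n K (ξ : V1 n K) = 0)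
    -- the inclusion V_S ↪ V induces an isomorphism of the symplectic quotients
    ∧ ∃ e : (↥(VS n K) ⧸ LinearMap.ker ((Theta n K).comp (VS n K).subtype))
          ≃ₗ[ℝ] (V1 n K ⧸ LinearMap.ker (Theta n K)),
        (∀ ξ : ↥(VS n K),
          e (Submodule.Quotient.mk ξ) = Submodule.Quotient.mk (ξ : V1 n K))
        ∧ ∃ (BS : (↥(VS n K) ⧸ LinearMap.ker ((Theta n K).comp (VS n K).subtype))
              → (↥(VS n K) ⧸ LinearMap.ker ((Theta n K).comp (VS n K).subtype)) → ℝ)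
            (B : (V1 n K ⧸ LinearMap.ker (Theta n K))
              → (V1 n K ⧸ LinearMap.ker (Theta n K)) → ℝ),
            (∀ ξ ξ' : ↥(VS n K),
              BS (Submodule.Quotient.mk ξ) (Submodule.Quotient.mk ξ')
                = Omega1 n K (ξ : V1 n K) (ξ' : V1 n K))
            ∧ (∀ ξ ξ' : V1 n K,
              B (Submodule.Quotient.mk ξ) (Submodule.Quotient.mk ξ')
                = Omega1 n K ξ ξ')
            ∧ (∀ q, (∀ q', BS q q' = 0) → q = 0)
            ∧ (∀ q, (∀ q', B q q' = 0) → q = 0)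
            ∧ (∀ q q', B (e q) (e q') = BS q q') := by
  let ΘS := (Theta n K).comp (VS n K).subtype
  have hS : Function.Surjective ΘS := fun y =>
    ⟨⟨symLift n K y.1 y.2, symLift_mem_VS n K y.1 y.2⟩, Theta_symLift K hn y.1 y.2⟩
  have hV : Function.Surjective (Theta n K) := fun y =>
    ⟨symLift n K y.1 y.2, Theta_symLift K hn y.1 y.2⟩
  refine ⟨fun targ => ⟨symLift n K 0 targ, symLift_mem_VS n K 0 targ,
    Jfam_symLift K hn 0 targ⟩, fun ξ => ⟨fun h => ?_, fun h ξ' => ?_⟩, ?_⟩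
  · refine canonicalForm_nondegenerate fun y => ?_
    obtain ⟨ξ', rfl⟩ := hS y
    exact (Omega1_eq_canonicalForm n K ξ ξ').symm.trans (h ξ')
  · rw [Omega1_eq_canonicalForm, h, canonicalForm_zero_left]
  · let ES := ΘS.quotKerEquivOfSurjective hS
    let EV := (Theta n K).quotKerEquivOfSurjective hV
    refine ⟨ES.trans EV.symm, fun ξ => EV.symm_apply_eq.2 rfl,
      fun q q' => canonicalForm (ES q) (ES q'), fun q q' => canonicalForm (EV q) (EV q'),
      fun ξ ξ' => (Omega1_eq_canonicalForm n K ξ ξ').symm,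
      fun ξ ξ' => (Omega1_eq_canonicalForm n K ξ ξ').symm,
      fun q h => ?_, fun q h => ?_, fun q q' => ?_⟩
    · refine ES.map_eq_zero_iff.1 (canonicalForm_nondegenerate fun y => ?_)
      simpa using h (ES.symm y)
    · refine EV.map_eq_zero_iff.1 (canonicalForm_nondegenerate fun y => ?_)
      simpa using h (EV.symm y)
    · simp
end
end

section
/- Let l ≥ 1 and let L₀ be the total divergence of smooth functions F^λ of jet variables of order ≤ l−1, so that L₀ is an l-th order Lagrangian. Then for every smooth φ : ℝ^n → ℝ, the momenta defined by p^{μ₁…μ_m λ}(x) := (∂F^λ/∂u_{μ₁…μ_m}) evaluated along the (l−1)-jet of φ (for 0 ≤ m ≤ l−1) satisfy the canonical first-order Euler–Lagrange system of L₀ for (φ, p). In particular, every smooth section φ, together with these momenta, is a solution of the field equations of the total-divergence Lagrangian L₀. -/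
noncomputable section

open scoped BigOperators

/-- Points of the base `ℝⁿ`. -/
abbrev Vec (n : ℕ) : Type := Fin n → ℝ

/-- The space of jet variables `(u_{μ₁…μ_r})_{0 ≤ r ≤ k}` of order `≤ k`
(arrays indexed by tuples of indices). -/
abbrev JetU (n k : ℕ) : Type := ∀ r : Fin (k + 1), (Fin (r : ℕ) → Fin n) → ℝ

/-- The full variable space `(x^μ; u_{μ₁…μ_r}, 0 ≤ r ≤ k)` of a `k`-th order
Lagrangian. -/
abbrev Jet (n k : ℕ) : Type := Vec n × JetU n k

/-- Iterated partial derivative `∂_{t 0} ⋯ ∂_{t (l-1)} g` at `x`. -/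
def pderivIter (n l : ℕ) (t : Fin l → Fin n) (g : Vec n → ℝ) (x : Vec n) : ℝ :=
  iteratedFDeriv ℝ l g x fun i => Pi.single (t i) 1

/-- Partial derivative `∂_λ g` at `x`. -/
def pderiv1 (n : ℕ) (lam : Fin n) (g : Vec n → ℝ) (x : Vec n) : ℝ :=
  fderiv ℝ g x (Pi.single lam 1)

/-- The `k`-jet of `φ` at `x`: substitute `u_{μ₁…μ_r} = ∂_{μ₁}⋯∂_{μ_r} φ(x)`. -/
def jetEv (n k : ℕ) (φ : Vec n → ℝ) (x : Vec n) : Jet n k :=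
  (x, fun r t => pderivIter n (r : ℕ) t φ x)

/-- The symmetric array `∂L/∂u_{μ₁…μ_r}` (the array characterized by the fact
that its full contraction with a symmetric increment of the rank-`r` jet
variables is the corresponding directional derivative of `L`), evaluated at the
tuple `t` and the point `z`. -/
def dLdu (n k : ℕ) (L : Jet n k → ℝ) (r : Fin (k + 1)) (t : Fin (r : ℕ) → Fin n)
    (z : Jet n k) : ℝ :=
  ((r : ℕ).factorial : ℝ)⁻¹ *
    ∑ σ : Equiv.Perm (Fin (r : ℕ)),
      fderiv ℝ L z (0, Pi.single r (Pi.single (t ∘ σ) 1))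

/-- Total symmetrization `q^{(μ₁…μ_l λ)}` of a momentum array
`q^{μ₁…μ_l λ}`, evaluated at the length-`(l+1)` tuple `s`. -/
def symComb (n l : ℕ) (q : (Fin l → Fin n) → Fin n → ℝ) (s : Fin (l + 1) → Fin n) : ℝ :=
  ((l + 1).factorial : ℝ)⁻¹ *
    ∑ σ : Equiv.Perm (Fin (l + 1)),
      q (fun i => s (σ (Fin.castSucc i))) (s (σ (Fin.last l)))

/-- Momenta `p^{μ₁…μ_l λ}` (`0 ≤ l ≤ k−1`) for a `k`-th order theory:
fields on `ℝⁿ` indexed by a tuple `μ₁…μ_l` and an extra index `λ`. -/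
abbrev Mom (n k : ℕ) : Type := ∀ l : Fin k, (Fin (l : ℕ) → Fin n) → Fin n → Vec n → ℝ

/-- `C^∞` smoothness. -/
def IsCInf {E F : Type*} [NormedAddCommGroup E] [NormedSpace ℝ E]
    [NormedAddCommGroup F] [NormedSpace ℝ F] (f : E → F) : Prop :=
  ∀ m : ℕ, ContDiff ℝ m f

/-- All components of the momenta are smooth. -/
def MomSmooth (n k : ℕ) (p : Mom n k) : Prop :=
  ∀ (l : Fin k) (t : Fin (l : ℕ) → Fin n) (lam : Fin n), IsCInf (p l t lam)

/-- The momenta are symmetric in the indices `μ₁…μ_l`. -/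
def MomSym (n k : ℕ) (p : Mom n k) : Prop :=
  ∀ (l : Fin k) (σ : Equiv.Perm (Fin (l : ℕ))) (t : Fin (l : ℕ) → Fin n)
    (lam : Fin n) (x : Vec n), p l (t ∘ σ) lam x = p l t lam x

/-- The momenta are totally symmetric in all indices `μ₁…μ_l λ`. -/
def MomTotSym (n k : ℕ) (p : Mom n k) : Prop :=
  ∀ (l : Fin k) (σ : Equiv.Perm (Fin ((l : ℕ) + 1))) (s : Fin ((l : ℕ) + 1) → Fin n)
    (x : Vec n),
    p l (fun i => s (σ (Fin.castSucc i))) (s (σ (Fin.last (l : ℕ)))) x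
      = p l (fun i => s (Fin.castSucc i)) (s (Fin.last (l : ℕ))) x

/-- The canonical first-order Euler–Lagrange system of a `(K+1)`-th order
Lagrangian `L` for a pair `(φ, p)`:
`p^{(μ₁…μ_k)} = ∂L/∂u_{μ₁…μ_k}`;
`p^{(μ₁…μ_l)} = ∂L/∂u_{μ₁…μ_l} − Σ_λ ∂_λ p^{μ₁…μ_l λ}` for `1 ≤ l ≤ k−1`;
`0 = ∂L/∂u − Σ_λ ∂_λ p^λ`, all derivatives of `L` being evaluated along the
`k`-jet of `φ` (here `k = K+1`). -/
def CanonSys (n K : ℕ) (L : Jet n (K + 1) → ℝ) (φ : Vec n → ℝ) (p : Mom n (K + 1)) : Prop :=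
  (∀ x : Vec n,
      dLdu n (K + 1) L ⟨0, Nat.succ_pos _⟩ Fin.elim0 (jetEv n (K + 1) φ x)
        - ∑ lam : Fin n, pderiv1 n lam (p ⟨0, Nat.succ_pos _⟩ Fin.elim0 lam) x = 0)
  ∧ (∀ (l : Fin (K + 1)) (s : Fin ((l : ℕ) + 1) → Fin n) (x : Vec n),
      symComb n (l : ℕ) (fun t lam => p l t lam x) s
        = dLdu n (K + 1) L ⟨(l : ℕ) + 1, Nat.succ_lt_succ l.isLt⟩ s (jetEv n (K + 1) φ x)
          - if h : (l : ℕ) + 1 < K + 1 then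
              ∑ lam : Fin n, pderiv1 n lam (p ⟨(l : ℕ) + 1, h⟩ s lam) x
            else 0)

/-- The Euler–Lagrange equation of order `2k` (`k = K+1`) of `L` for `φ`:
`Σ_{r=0}^{k} (−1)^r Σ_{μ₁…μ_r} ∂_{μ₁}⋯∂_{μ_r}[∂L/∂u_{μ₁…μ_r} ∘ (k-jet of φ)] = 0`. -/
def ELeq (n K : ℕ) (L : Jet n (K + 1) → ℝ) (φ : Vec n → ℝ) : Prop :=
  ∀ x : Vec n,
    ∑ r : Fin (K + 2),
      ((-1 : ℝ) ^ (r : ℕ)) *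
        ∑ t : Fin (r : ℕ) → Fin n,
          pderivIter n (r : ℕ) t
            (fun y => dLdu n (K + 1) L r t (jetEv n (K + 1) φ y)) x
      = 0
/-- Truncation of a jet of order `k` to a jet of order `J ≤ k`. -/
def truncJet (n J k : ℕ) (h : J ≤ k) (z : Jet n k) : Jet n J :=
  (z.1, fun r t => z.2 ⟨(r : ℕ), lt_of_lt_of_le r.isLt (Nat.succ_le_succ h)⟩ t)

/-- The total divergence of a family `F^λ` of functions of jet variables of
order `≤ J`:  the `(J+1)`-th order Lagrangian
`L₀ = Σ_λ [∂F^λ/∂x^λ + Σ_{m=0}^{J} Σ_{μ₁…μ_m} (∂F^λ/∂u_{μ₁…μ_m}) u_{μ₁…μ_m λ}]`. -/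
def totalDiv (n J : ℕ) (F : Fin n → Jet n J → ℝ) (z : Jet n (J + 1)) : ℝ :=
  ∑ lam : Fin n,
    (fderiv ℝ (F lam) (truncJet n J (J + 1) (Nat.le_succ J) z) (Pi.single lam 1, 0)
      + ∑ m : Fin (J + 1), ∑ t : Fin (m : ℕ) → Fin n,
          dLdu n J (F lam) m t (truncJet n J (J + 1) (Nat.le_succ J) z)
            * z.2 ⟨(m : ℕ) + 1, Nat.succ_lt_succ m.isLt⟩ (Fin.snoc t lam))

/-- The direction in jet space dual to `u_{t 0 … t (r-1)}`, symmetrized in the indices. -/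
def symDir (n k : ℕ) (r : Fin (k + 1)) (t : Fin (r : ℕ) → Fin n) : JetU n k :=
  ((r : ℕ).factorial : ℝ)⁻¹ •
    ∑ σ : Equiv.Perm (Fin (r : ℕ)), Pi.single r (Pi.single (t ∘ σ) 1)

theorem dLdu_eq_fderiv_symDir (n k : ℕ) (L : Jet n k → ℝ) (r : Fin (k + 1))
    (t : Fin (r : ℕ) → Fin n) (z : Jet n k) :
    dLdu n k L r t z = fderiv ℝ L z (0, symDir n k r t) := by
  have h : ((0, symDir n k r t) : Jet n k) = ((r : ℕ).factorial : ℝ)⁻¹ •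
      ∑ σ : Equiv.Perm (Fin (r : ℕ)), ((0, Pi.single r (Pi.single (t ∘ σ) 1)) : Jet n k) := by
    apply Prod.ext
    · simp [Prod.fst_sum]
    · simp [symDir, Prod.snd_sum]
  rw [h, map_smul, map_sum, dLdu, smul_eq_mul]

theorem sum_smul_symDir (n k : ℕ) (r : Fin (k + 1)) (c : (Fin (r : ℕ) → Fin n) → ℝ)
    (hc : ∀ (σ : Equiv.Perm (Fin (r : ℕ))) t, c (t ∘ σ) = c t) :
    ∑ t, c t • symDir n k r t = Pi.single r c := by
  have key : ∀ σ : Equiv.Perm (Fin (r : ℕ)),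
      ∑ t, c t • (Pi.single r (Pi.single (t ∘ σ) 1) : JetU n k) = Pi.single r c := by
    intro σ
    have h1 : ∑ t, c t • (Pi.single r (Pi.single (t ∘ σ) 1) : JetU n k)
        = ∑ t, c t • (Pi.single r (Pi.single t 1) : JetU n k) := by
      refine Fintype.sum_equiv (σ.symm.arrowCongr (Equiv.refl (Fin n))) _ _ fun t => ?_
      have : (σ.symm.arrowCongr (Equiv.refl (Fin n))) t = t ∘ σ := by
        ext i; simp [Equiv.arrowCongr]
      rw [this, hc]
    rw [h1]
    have h2 : ∀ t, c t • (Pi.single r (Pi.single t 1) : JetU n k)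
        = Pi.single r (Pi.single t (c t)) := by
      intro t
      rw [← Pi.single_smul, ← Pi.single_smul, smul_eq_mul, mul_one]
    simp_rw [h2]
    conv_rhs => rw [← Finset.univ_sum_single c]
    exact (map_sum (AddMonoidHom.single (fun r : Fin (k + 1) => (Fin (r : ℕ) → Fin n) → ℝ) r)
      _ _).symm
  have hr : ((r : ℕ).factorial : ℝ) ≠ 0 := by positivity
  calc ∑ t, c t • symDir n k r t
      = ((r : ℕ).factorial : ℝ)⁻¹ • ∑ σ : Equiv.Perm (Fin (r : ℕ)),
          ∑ t, c t • (Pi.single r (Pi.single (t ∘ σ) 1) : JetU n k) := by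
        simp_rw [symDir, Finset.smul_sum]
        rw [Finset.sum_comm]
        exact Finset.sum_congr rfl fun σ _ => Finset.sum_congr rfl fun t _ => smul_comm _ _ _
    _ = Pi.single r c := by
        simp_rw [key]
        rw [Finset.sum_const, Finset.card_univ, Fintype.card_perm, Fintype.card_fin,
          ← Nat.cast_smul_eq_nsmul ℝ, smul_smul, inv_mul_cancel₀ hr, one_smul]

/-- Truncation of jets as a continuous linear map. -/
def truncJetL (n J : ℕ) : Jet n (J + 1) →L[ℝ] Jet n J :=
  LinearMap.toContinuousLinearMap
    { toFun := truncJet n J (J + 1) (Nat.le_succ J)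
      map_add' := fun _ _ => rfl
      map_smul' := fun _ _ => rfl }

theorem truncJetL_apply (n J : ℕ) (z : Jet n (J + 1)) :
    truncJetL n J z = truncJet n J (J + 1) (Nat.le_succ J) z := rfl

/-- The vertical part of the total derivative `d/dx^λ`, as a linear function of the jet. -/
def vertL (n J : ℕ) (lam : Fin n) : Jet n (J + 1) →L[ℝ] Jet n J :=
  LinearMap.toContinuousLinearMap
    (∑ m : Fin (J + 1), ∑ t : Fin (m : ℕ) → Fin n,
      LinearMap.smulRight
        (LinearMap.proj (Fin.snoc t lam) ∘ₗ
          LinearMap.proj (R := ℝ) (φ := fun r : Fin (J + 2) => (Fin (r : ℕ) → Fin n) → ℝ)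
            ⟨(m : ℕ) + 1, Nat.succ_lt_succ m.isLt⟩ ∘ₗ LinearMap.snd ℝ (Vec n) (JetU n (J + 1)))
        ((0, symDir n J m t) : Jet n J))

theorem vertL_apply (n J : ℕ) (lam : Fin n) (z : Jet n (J + 1)) :
    vertL n J lam z = ∑ m : Fin (J + 1), ∑ t : Fin (m : ℕ) → Fin n,
      z.2 ⟨(m : ℕ) + 1, Nat.succ_lt_succ m.isLt⟩ (Fin.snoc t lam) •
        ((0, symDir n J m t) : Jet n J) := by
  simp [vertL]

theorem vertL_vertical (n J : ℕ) (lam : Fin n) (w : JetU n (J + 1)) :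
    vertL n J lam (0, w) = ∑ m : Fin (J + 1), ∑ t : Fin (m : ℕ) → Fin n,
      w ⟨(m : ℕ) + 1, Nat.succ_lt_succ m.isLt⟩ (Fin.snoc t lam) •
        ((0, symDir n J m t) : Jet n J) :=
  vertL_apply n J lam (0, w)

theorem totalDiv_eq (n J : ℕ) (F : Fin n → Jet n J → ℝ) (z : Jet n (J + 1)) :
    totalDiv n J F z = ∑ lam : Fin n,
      fderiv ℝ (F lam) (truncJetL n J z) ((Pi.single lam 1, 0) + vertL n J lam z) := by
  unfold totalDiv
  refine Finset.sum_congr rfl fun lam _ => ?_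
  rw [map_add, vertL_apply, map_sum, truncJetL_apply]
  congr 1
  refine Finset.sum_congr rfl fun m _ => ?_
  rw [map_sum]
  refine Finset.sum_congr rfl fun t _ => ?_
  rw [map_smul, dLdu_eq_fderiv_symDir, smul_eq_mul, mul_comm]

theorem IsCInf.differentiable_fderiv {E G : Type*} [NormedAddCommGroup E] [NormedSpace ℝ E]
    [NormedAddCommGroup G] [NormedSpace ℝ G] {f : E → G} (hf : IsCInf f) :
    Differentiable ℝ (fderiv ℝ f) :=
  ((hf 2).fderiv_right (m := 1) (by norm_num)).differentiable (by norm_num)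

theorem fderiv_sum_fderiv_comp_apply {ι E G : Type*} [Fintype ι]
    [NormedAddCommGroup E] [NormedSpace ℝ E] [NormedAddCommGroup G] [NormedSpace ℝ G]
    (F : ι → G → ℝ) (hF : ∀ i, IsCInf (F i)) (T : E →L[ℝ] G) (V : ι → E →L[ℝ] G) (e : ι → G)
    (z v : E) :
    fderiv ℝ (fun z => ∑ i, fderiv ℝ (F i) (T z) (e i + V i z)) z v
      = ∑ i, (fderiv ℝ (fderiv ℝ (F i)) (T z) (e i + V i z) (T v)
        + fderiv ℝ (F i) (T z) (V i v)) := by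
  have h := fun i =>
    (((hF i).differentiable_fderiv (T z)).hasFDerivAt.comp z T.hasFDerivAt).clm_apply
      ((V i).hasFDerivAt.const_add (e i) (x := z))
  have h2 := (HasFDerivAt.fun_sum (u := Finset.univ) fun i _ => h i).fderiv
  simp only [Function.comp_apply] at h2
  rw [h2, sum_apply]
  refine Finset.sum_congr rfl fun i _ => ?_
  have hs : IsSymmSndFDerivAt ℝ (F i) (T z) :=
    (hF i 2).contDiffAt.isSymmSndFDerivAt (by simp)
  rw [hs (e i + V i z)]
  simp [add_comm]

theorem fderiv_totalDiv_apply (n J : ℕ) (F : Fin n → Jet n J → ℝ) (hF : ∀ lam, IsCInf (F lam))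
    (z v : Jet n (J + 1)) :
    fderiv ℝ (totalDiv n J F) z v = ∑ lam : Fin n,
      (fderiv ℝ (fderiv ℝ (F lam)) (truncJetL n J z) ((Pi.single lam 1, 0) + vertL n J lam z)
          (truncJetL n J v)
        + fderiv ℝ (F lam) (truncJetL n J z) (vertL n J lam v)) := by
  rw [funext (totalDiv_eq n J F)]
  exact fderiv_sum_fderiv_comp_apply F hF (truncJetL n J) (vertL n J)
    (fun lam => (Pi.single lam 1, 0)) z v

theorem isCInf_pderivIter (n m : ℕ) (φ : Vec n → ℝ) (hφ : IsCInf φ) (t : Fin m → Fin n) :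
    IsCInf (pderivIter n m t φ) := by
  intro k
  have h : ContDiff ℝ k (iteratedFDeriv ℝ m φ) :=
    (hφ (k + m)).iteratedFDeriv_right (by norm_cast)
  exact (ContinuousMultilinearMap.apply ℝ (fun _ : Fin m => Vec n) ℝ
    fun i => Pi.single (t i) 1).contDiff.comp h

theorem fderiv_pderivIter (n m : ℕ) (φ : Vec n → ℝ) (hφ : IsCInf φ) (x : Vec n)
    (t : Fin m → Fin n) (lam : Fin n) :
    fderiv ℝ (pderivIter n m t φ) x (Pi.single lam 1)
      = pderivIter n (m + 1) (Fin.cons lam t) φ x := by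
  have hd : DifferentiableAt ℝ (iteratedFDeriv ℝ m φ) x :=
    (hφ (m + 1)).differentiable_iteratedFDeriv (by exact_mod_cast Nat.lt_succ_self m) x
  have h := (ContinuousMultilinearMap.apply ℝ (fun _ : Fin m => Vec n) ℝ
    fun i => Pi.single (t i) 1).hasFDerivAt.comp x hd.hasFDerivAt
  have h' : fderiv ℝ (pderivIter n m t φ) x = _ := h.fderiv
  rw [h', pderivIter, iteratedFDeriv_succ_apply_left]
  rfl

theorem pderivIter_comp_swap (n m : ℕ) (φ : Vec n → ℝ) (hφ : IsCInf φ) (i : Fin m) (x : Vec n)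
    (t : Fin (m + 1) → Fin n) :
    pderivIter n (m + 1) (t ∘ Equiv.swap i.castSucc i.succ) φ x = pderivIter n (m + 1) t φ x := by
  induction m generalizing x with
  | zero => exact i.elim0
  | succ m ih =>
    cases i using Fin.cases with
    | zero =>
      obtain ⟨a, t, rfl⟩ : ∃ a t', t = Fin.cons a t' :=
        ⟨t 0, Fin.tail t, (Fin.cons_self_tail t).symm⟩
      obtain ⟨b, t, rfl⟩ : ∃ b t', t = Fin.cons b t' :=
        ⟨t 0, Fin.tail t, (Fin.cons_self_tail t).symm⟩
      have hs : (Fin.cons a (Fin.cons b t : Fin (m + 1) → Fin n) : Fin (m + 2) → Fin n) ∘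
          Equiv.swap (0 : Fin (m + 1)).castSucc (0 : Fin (m + 1)).succ
          = Fin.cons b (Fin.cons a t : Fin (m + 1) → Fin n) :=
        Matrix.cons_cons_comp_swap_zero_one a b t
      rw [hs]
      have hg := isCInf_pderivIter n m φ hφ t
      have key : ∀ c d : Fin n,
          pderivIter n (m + 2) (Fin.cons c (Fin.cons d t : Fin (m + 1) → Fin n)) φ x
          = fderiv ℝ (fderiv ℝ (pderivIter n m t φ)) x (Pi.single c 1) (Pi.single d 1) := by
        intro c d
        rw [← fderiv_pderivIter n (m + 1) φ hφ]
        simp_rw [← funext fun y => fderiv_pderivIter n m φ hφ y t d]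
        rw [((hg.differentiable_fderiv x).hasFDerivAt.clm_apply
          (hasFDerivAt_const (Pi.single d 1 : Vec n) x)).fderiv]
        simp
      rw [key, key]
      exact (hg 2).contDiffAt.isSymmSndFDerivAt (by simp) _ _
    | succ j =>
      obtain ⟨a, t, rfl⟩ : ∃ a t', t = Fin.cons a t' :=
        ⟨t 0, Fin.tail t, (Fin.cons_self_tail t).symm⟩
      have hs : (Fin.cons a t : Fin (m + 2) → Fin n) ∘ Equiv.swap j.succ.castSucc j.succ.succ
          = Fin.cons a (t ∘ Equiv.swap j.castSucc j.succ) := by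
        funext k
        cases k using Fin.cases with
        | zero =>
          rw [Function.comp_apply, Equiv.swap_apply_of_ne_of_ne] <;> simp [Fin.ext_iff]
        | succ k =>
          rw [Function.comp_apply, ← Fin.succ_castSucc,
            (Fin.succ_injective _).swap_apply]
          simp
      rw [hs, ← fderiv_pderivIter n (m + 1) φ hφ, ← fderiv_pderivIter n (m + 1) φ hφ]
      congr 2
      exact funext fun y => ih j y t

theorem pderivIter_comp_perm (n m : ℕ) (φ : Vec n → ℝ) (hφ : IsCInf φ) (x : Vec n)
    (σ : Equiv.Perm (Fin m)) (t : Fin m → Fin n) :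
    pderivIter n m (t ∘ σ) φ x = pderivIter n m t φ x := by
  cases m with
  | zero => rw [Subsingleton.elim (t ∘ σ) t]
  | succ m =>
    have hσ : σ ∈ Submonoid.closure
        (Set.range fun i : Fin m => Equiv.swap i.castSucc i.succ) := by
      rw [Equiv.Perm.mclosure_swap_castSucc_succ]
      exact Submonoid.mem_top σ
    induction hσ using Submonoid.closure_induction generalizing t with
    | mem σ h =>
      obtain ⟨i, rfl⟩ := h
      exact pderivIter_comp_swap n m φ hφ i x t
    | one => rfl
    | mul σ τ _ _ h₁ h₂ =>
      rw [Equiv.Perm.coe_mul, ← Function.comp_assoc, h₂, h₁]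

theorem pderivIter_snoc (n m : ℕ) (φ : Vec n → ℝ) (hφ : IsCInf φ) (x : Vec n)
    (t : Fin m → Fin n) (lam : Fin n) :
    pderivIter n (m + 1) (Fin.snoc t lam) φ x = pderivIter n (m + 1) (Fin.cons lam t) φ x := by
  rw [← pderivIter_comp_perm n (m + 1) φ hφ x (finRotate (m + 1)) (Fin.cons lam t)]
  congr 1
  exact Fin.snoc_eq_cons_rotate t lam

theorem fderiv_jetEv_apply (n J : ℕ) (φ : Vec n → ℝ) (hφ : IsCInf φ) (x : Vec n) (lam : Fin n) :
    DifferentiableAt ℝ (jetEv n J φ) x ∧ fderiv ℝ (jetEv n J φ) x (Pi.single lam 1)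
      = (Pi.single lam 1, 0) + vertL n J lam (jetEv n (J + 1) φ x) := by
  have h : HasFDerivAt (jetEv n J φ) ((ContinuousLinearMap.id ℝ (Vec n)).prod
      (ContinuousLinearMap.pi fun r : Fin (J + 1) => ContinuousLinearMap.pi
        fun t : Fin (r : ℕ) → Fin n => fderiv ℝ (pderivIter n r t φ) x)) x := by
    refine (hasFDerivAt_id x).prodMk (hasFDerivAt_pi.2 fun r => hasFDerivAt_pi.2 fun t => ?_)
    exact ((isCInf_pderivIter n r φ hφ t 1).differentiable (by norm_num) x).hasFDerivAt
  refine ⟨h.differentiableAt, ?_⟩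
  rw [h.fderiv, vertL_apply]
  have hv : ∀ m : Fin (J + 1), ∑ t : Fin (m : ℕ) → Fin n,
      pderivIter n (m + 1) (Fin.cons lam t) φ x • symDir n J m t
        = Pi.single m fun t => pderivIter n (m + 1) (Fin.cons lam t) φ x := by
    intro m
    apply sum_smul_symDir
    intro σ t
    simp_rw [← fderiv_pderivIter n m φ hφ x]
    congr 2
    funext y
    exact pderivIter_comp_perm n m φ hφ y σ t
  apply Prod.ext
  · simp [Prod.fst_sum]
  · simp only [jetEv, pderivIter_snoc n _ φ hφ x]
    simp only [Prod.snd_add, Prod.snd_sum, Prod.smul_snd, hv, zero_add,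
      Finset.univ_sum_single (fun (m : Fin (J + 1)) (t : Fin (m : ℕ) → Fin n) =>
        pderivIter n (m + 1) (Fin.cons lam t) φ x)]
    funext r t
    exact fderiv_pderivIter n r φ hφ x t lam

theorem pderiv1_dLdu_jetEv (n J : ℕ) (F : Jet n J → ℝ) (hF : IsCInf F)
    (φ : Vec n → ℝ) (hφ : IsCInf φ) (x : Vec n) (lam : Fin n) (m : Fin (J + 1))
    (t : Fin (m : ℕ) → Fin n) :
    pderiv1 n lam (fun y => dLdu n J F m t (jetEv n J φ y)) x
      = fderiv ℝ (fderiv ℝ F) (jetEv n J φ x)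
          ((Pi.single lam 1, 0) + vertL n J lam (jetEv n (J + 1) φ x))
          (0, symDir n J m t) := by
  obtain ⟨hd, he⟩ := fderiv_jetEv_apply n J φ hφ x lam
  have h := ((hF.differentiable_fderiv (jetEv n J φ x)).hasFDerivAt.comp x
    hd.hasFDerivAt).clm_apply (hasFDerivAt_const ((0, symDir n J m t) : Jet n J) x)
  unfold pderiv1
  simp_rw [dLdu_eq_fderiv_symDir]
  have h3 := h.fderiv
  simp only [Function.comp_apply] at h3
  rw [h3, ← he]
  simp

theorem symDir_apply_ne (n k : ℕ) (r r' : Fin (k + 1)) (h : r' ≠ r) (t : Fin (r : ℕ) → Fin n) :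
    symDir n k r t r' = 0 := by
  simp [symDir, Finset.sum_apply, Pi.single_eq_of_ne h]

theorem symDir_apply_self (n k : ℕ) (r : Fin (k + 1)) (t u : Fin (r : ℕ) → Fin n) :
    symDir n k r t r u = ((r : ℕ).factorial : ℝ)⁻¹ *
      ∑ σ : Equiv.Perm (Fin (r : ℕ)), (Pi.single (t ∘ σ) 1 : (Fin (r : ℕ) → Fin n) → ℝ) u := by
  simp [symDir, Finset.sum_apply]

theorem truncJetL_symDir (n J q : ℕ) (h : q < J + 1) (s : Fin q → Fin n) :
    truncJetL n J (0, symDir n (J + 1) ⟨q, h.trans (Nat.lt_succ_self _)⟩ s)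
      = (0, symDir n J ⟨q, h⟩ s) := by
  rw [truncJetL_apply]
  refine Prod.ext rfl (funext fun r => funext fun u => ?_)
  by_cases hr : r = ⟨q, h⟩
  · subst hr
    exact (symDir_apply_self n (J + 1) ⟨q, _⟩ s u).trans (symDir_apply_self n J ⟨q, h⟩ s u).symm
  · exact (congrFun (symDir_apply_ne n (J + 1) ⟨q, _⟩ ⟨r, _⟩
      (fun e => hr (Fin.ext (Fin.mk.inj_iff.1 e))) s) u).trans
      (congrFun (symDir_apply_ne n J ⟨q, h⟩ r hr s) u).symm

theorem truncJetL_symDir_last (n J : ℕ) (s : Fin (J + 1) → Fin n) :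
    truncJetL n J (0, symDir n (J + 1) ⟨J + 1, Nat.lt_succ_self _⟩ s) = 0 := by
  rw [truncJetL_apply]
  refine Prod.ext rfl (funext fun r => funext fun u => ?_)
  exact congrFun (symDir_apply_ne n (J + 1) ⟨J + 1, _⟩ ⟨r, _⟩
      (fun e => r.isLt.ne (Fin.mk.inj_iff.1 e)) s) u

theorem vertL_symDir_zero (n J : ℕ) (lam : Fin n) (s : Fin 0 → Fin n) :
    vertL n J lam (0, symDir n (J + 1) ⟨0, Nat.succ_pos _⟩ s) = 0 := by
  rw [vertL_vertical]
  refine Finset.sum_eq_zero fun m _ => Finset.sum_eq_zero fun t _ => ?_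
  have h : symDir n (J + 1) ⟨0, Nat.succ_pos _⟩ s ⟨(m : ℕ) + 1, Nat.succ_lt_succ m.isLt⟩
      (Fin.snoc t lam) = 0 :=
    congrFun (symDir_apply_ne n (J + 1) ⟨0, Nat.succ_pos _⟩
      ⟨(m : ℕ) + 1, Nat.succ_lt_succ m.isLt⟩ (by simp) s) (Fin.snoc t lam)
  rw [h, zero_smul]

theorem sum_fderiv_vertL_symDir (n J : ℕ) (F : Fin n → Jet n J → ℝ) (l : Fin (J + 1))
    (s : Fin ((l : ℕ) + 1) → Fin n) (y : Jet n J) :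
    ∑ lam : Fin n, fderiv ℝ (F lam) y
        (vertL n J lam (0, symDir n (J + 1) ⟨(l : ℕ) + 1, Nat.succ_lt_succ l.isLt⟩ s))
      = symComb n l (fun t lam => dLdu n J (F lam) l t y) s := by
  set r : Fin (J + 2) := ⟨(l : ℕ) + 1, Nat.succ_lt_succ l.isLt⟩
  have h1 : ∀ lam : Fin n, fderiv ℝ (F lam) y (vertL n J lam (0, symDir n (J + 1) r s))
      = ∑ t : Fin (l : ℕ) → Fin n,
          symDir n (J + 1) r s r (Fin.snoc t lam : Fin ((l : ℕ) + 1) → Fin n)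
            * dLdu n J (F lam) l t y := by
    intro lam
    rw [vertL_vertical, Finset.sum_eq_single l]
    · simp_rw [map_sum, map_smul, dLdu_eq_fderiv_symDir, smul_eq_mul]
      rfl
    · intro m _ hm
      refine Finset.sum_eq_zero fun t _ => ?_
      have h : symDir n (J + 1) r s ⟨(m : ℕ) + 1, Nat.succ_lt_succ m.isLt⟩
          (Fin.snoc t lam) = 0 :=
        congrFun (symDir_apply_ne n (J + 1) r _
          (fun e => hm (Fin.ext (Nat.succ.inj (Fin.mk.inj_iff.1 e)))) s) (Fin.snoc t lam)
      rw [h, zero_smul]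
    · exact fun h => absurd (Finset.mem_univ l) h
  refine (Finset.sum_congr rfl fun lam _ => h1 lam).trans ?_
  have h2 := Fintype.sum_equiv (Fin.snocEquiv fun _ : Fin ((l : ℕ) + 1) => Fin n)
    (fun q : Fin n × (Fin (l : ℕ) → Fin n) =>
      symDir n (J + 1) r s r (Fin.snoc q.2 q.1 : Fin ((l : ℕ) + 1) → Fin n)
            * dLdu n J (F q.1) l q.2 y)
    (fun u : Fin ((l : ℕ) + 1) → Fin n => symDir n (J + 1) r s r u
            * dLdu n J (F (u (Fin.last l))) l (fun i => u (Fin.castSucc i)) y)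
    (fun q => by simp [Fin.snocEquiv])
  rw [Fintype.sum_prod_type] at h2
  rw [h2]
  have h3 : ∀ u : Fin ((l : ℕ) + 1) → Fin n, symDir n (J + 1) r s r u
      = (((l : ℕ) + 1).factorial : ℝ)⁻¹ * ∑ σ : Equiv.Perm (Fin ((l : ℕ) + 1)),
        (Pi.single (s ∘ σ) 1 : (Fin ((l : ℕ) + 1) → Fin n) → ℝ) u :=
    symDir_apply_self n (J + 1) r s
  simp_rw [h3, mul_assoc]
  rw [← Finset.mul_sum, symComb]
  congr 1
  simp_rw [Finset.sum_mul]
  rw [Finset.sum_comm]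
  refine Finset.sum_congr rfl fun σ _ => ?_
  rw [Finset.sum_eq_single (s ∘ σ)]
  · simp
  · intro u _ hu
    rw [Pi.single_eq_of_ne hu, zero_mul]
  · simp

theorem dLdu_totalDiv_jetEv (n J : ℕ) (F : Fin n → Jet n J → ℝ) (hF : ∀ lam, IsCInf (F lam))
    (φ : Vec n → ℝ) (hφ : IsCInf φ) (x : Vec n) (q : ℕ) (h : q < J + 1) (s : Fin q → Fin n) :
    dLdu n (J + 1) (totalDiv n J F) ⟨q, h.trans (Nat.lt_succ_self _)⟩ s (jetEv n (J + 1) φ x)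
      = ∑ lam, pderiv1 n lam (fun y => dLdu n J (F lam) ⟨q, h⟩ s (jetEv n J φ y)) x
        + ∑ lam, fderiv ℝ (F lam) (jetEv n J φ x)
          (vertL n J lam (0, symDir n (J + 1) ⟨q, h.trans (Nat.lt_succ_self _)⟩ s)) := by
  rw [dLdu_eq_fderiv_symDir, fderiv_totalDiv_apply n J F hF, Finset.sum_add_distrib,
    truncJetL_symDir n J q h]
  congr 1
  refine Finset.sum_congr rfl fun lam _ => ?_
  rw [pderiv1_dLdu_jetEv n J (F lam) (hF lam) φ hφ x lam]
  rfl

/-- total divergences solve their own canonical system.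
Let `L₀` be the total divergence of smooth functions `F^λ` of jet variables of
order `≤ l−1` (here `l = J+1 ≥ 1`), an `l`-th order Lagrangian.  Then for every
smooth `φ : ℝⁿ → ℝ` the momenta `p^{μ₁…μ_m λ} := (∂F^λ/∂u_{μ₁…μ_m})` evaluated
along the `(l−1)`-jet of `φ` satisfy the canonical first-order Euler–Lagrange
system of `L₀` for `(φ, p)`; i.e. every smooth section, together with these
momenta, is a solution of the field equations of `L₀`. -/
theorem statement_8 (n J : ℕ) (hn : 1 ≤ n)
    (F : Fin n → Jet n J → ℝ) (hF : ∀ lam, IsCInf (F lam))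
    (φ : Vec n → ℝ) (hφ : IsCInf φ) :
    CanonSys n J (totalDiv n J F) φ
      (fun m t lam x => dLdu n J (F lam) m t (jetEv n J φ x)) := by
  refine ⟨fun x => ?_, fun l s x => ?_⟩
  · rw [dLdu_totalDiv_jetEv n J F hF φ hφ x 0 (Nat.succ_pos J) Fin.elim0]
    simp_rw [vertL_symDir_zero, map_zero, Finset.sum_const_zero, add_zero]
    exact sub_self _
  · rw [← sum_fderiv_vertL_symDir]
    split_ifs with h
    · rw [dLdu_totalDiv_jetEv n J F hF φ hφ x ((l : ℕ) + 1) h s]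
      exact (add_sub_cancel_left _ _).symm
    · obtain ⟨l, hl⟩ := l
      obtain rfl : l = J := by simp only at h; omega
      rw [sub_zero, dLdu_eq_fderiv_symDir, fderiv_totalDiv_apply n l F hF]
      simp_rw [truncJetL_symDir_last n l s, map_zero, zero_add]
      rfl
end
end
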